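/- arXiv:1504.07449 — 2 statements merged into one kernel-verified Lean document; each statement's English description precedes it below -/
import Mathlib

section
/- Let Γ be a finite simplicial graph satisfying property (B1), and let u, v, w be vertices with lk(v) ⊆ st(u) ∩ st(w). Let τ = τ_{u,v,w} ∈ Aut(A_Γ) be the automorphism sending v ↦ v[u,w] (where [u,w] = u⁻¹w⁻¹uw) and fixing all other generators. Then for every m ≥ 0, τ^m lies in the commutator subgroup of SIA_Γ(m). -/
open SimpleGraph

namespace RaagPaper

variable {V : Type} [Fintype V] [DecidableEq V]

/-- The defining relations of the right-angled Artin group of a graph `Γ`. -/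
def Rels (Γ : SimpleGraph V) : Set (FreeGroup V) :=
  {r | ∃ u v : V, Γ.Adj u v ∧
    r = FreeGroup.of u * FreeGroup.of v * (FreeGroup.of u)⁻¹ * (FreeGroup.of v)⁻¹}

/-- The right-angled Artin group of `Γ`. -/
abbrev Raag (Γ : SimpleGraph V) := PresentedGroup (Rels Γ)

/-- The generator of `Raag Γ` corresponding to the vertex `v`. -/
def gen (Γ : SimpleGraph V) (v : V) : Raag Γ := PresentedGroup.of v

/-- The link of a vertex. -/
def lk (Γ : SimpleGraph V) (v : V) : Set V := Γ.neighborSet v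

/-- The star of a vertex. -/
def st (Γ : SimpleGraph V) (v : V) : Set V := insert v (Γ.neighborSet v)

/-- The partial preorder `v ≤ w ↔ lk v ⊆ st w` on vertices. -/
def Le (Γ : SimpleGraph V) (v w : V) : Prop := lk Γ v ⊆ st Γ w

/-- The equivalence `v ∼ w`. -/
def Sim (Γ : SimpleGraph V) (v w : V) : Prop := Le Γ v w ∧ Le Γ w v

/-- The equivalence class of a vertex under `∼`. -/
def simClass (Γ : SimpleGraph V) (v : V) : Set V := {u | Sim Γ u v}

/-- Property (B1): any two distinct non-adjacent vertices are `∼`-equivalent. -/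
def B1 (Γ : SimpleGraph V) : Prop :=
  ∀ u v : V, u ≠ v → ¬ Γ.Adj u v → Sim Γ u v

/-- Property (B2). -/
def B2 (Γ : SimpleGraph V) : Prop :=
  ∀ v w : V, v ≠ w → Le Γ v w → ∃ u : V, u ≠ v ∧ u ≠ w ∧ Le Γ v u ∧ Le Γ u w

/-- `α` is the transvection `t_{vw}` for some `v ≤ w`. -/
def IsTransvection (Γ : SimpleGraph V) (α : MulAut (Raag Γ)) : Prop :=
  ∃ v w : V, v ≠ w ∧ Le Γ v w ∧ α (gen Γ v) = gen Γ v * gen Γ w ∧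
    ∀ z : V, z ≠ v → α (gen Γ z) = gen Γ z

/-- `Y` is (the vertex set of) a connected component of the subgraph of `Γ` induced on `S`. -/
def IsCompOf (Γ : SimpleGraph V) (S : Set V) (Y : Set V) : Prop :=
  ∃ C : (Γ.induce S).ConnectedComponent, Y = Subtype.val '' C.supp

/-- `α` is a partial conjugation `c_{v,Y}`. -/
def IsPartialConj (Γ : SimpleGraph V) (α : MulAut (Raag Γ)) : Prop :=
  ∃ (v : V) (Y : Set V), IsCompOf Γ (st Γ v)ᶜ Y ∧
    (∀ y ∈ Y, α (gen Γ y) = (gen Γ v)⁻¹ * gen Γ y * gen Γ v) ∧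
    (∀ z : V, z ∉ Y → α (gen Γ z) = gen Γ z)

/-- `α` is the inversion `ι_v`. -/
def IsInversion (Γ : SimpleGraph V) (α : MulAut (Raag Γ)) : Prop :=
  ∃ v : V, α (gen Γ v) = (gen Γ v)⁻¹ ∧ ∀ z : V, z ≠ v → α (gen Γ z) = gen Γ z

/-- `SAut⁰(A_Γ)`: the subgroup generated by transvections and partial conjugations. -/
def SAut0 (Γ : SimpleGraph V) : Subgroup (MulAut (Raag Γ)) :=
  Subgroup.closure {α | IsTransvection Γ α ∨ IsPartialConj Γ α}

/-- `Aut⁰(A_Γ)`: the subgroup generated by transvections, partial conjugations and inversions. -/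
def Aut0 (Γ : SimpleGraph V) : Subgroup (MulAut (Raag Γ)) :=
  Subgroup.closure {α | IsTransvection Γ α ∨ IsPartialConj Γ α ∨ IsInversion Γ α}

/-- The natural map `Aut(A_Γ) → Aut(A_Γ^{ab})`. -/
def abAutHom (Γ : SimpleGraph V) :
    MulAut (Raag Γ) →* MulAut (Abelianization (Raag Γ)) :=
  MonoidHom.mk' (fun e => MulEquiv.abelianizationCongr e) (by
    intro e f
    exact (abelianizationCongr_trans f e).symm)

/-- The Torelli subgroup `IA_Γ`. -/
def IA (Γ : SimpleGraph V) : Subgroup (MulAut (Raag Γ)) := (abAutHom Γ).ker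

/-- The subgroup of `m`-th powers of `A_Γ^{ab}`; the quotient by it is `A_Γ^{ab} ⊗ ℤ/mℤ`. -/
def powN (Γ : SimpleGraph V) (m : ℕ) : Subgroup (Abelianization (Raag Γ)) :=
  (powMonoidHom m : Abelianization (Raag Γ) →* Abelianization (Raag Γ)).range

/-- `IA_Γ(m)`: the kernel of `Aut(A_Γ) → Aut(A_Γ^{ab} ⊗ ℤ/mℤ)`, i.e. the automorphisms
acting trivially on the abelianization modulo `m`-th powers. -/
def IAm (Γ : SimpleGraph V) (m : ℕ) : Subgroup (MulAut (Raag Γ)) where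
  carrier := {α | ∀ x : Abelianization (Raag Γ), abAutHom Γ α x * x⁻¹ ∈ powN Γ m}
  one_mem' := by
    intro x
    simp only [map_one, MulAut.one_apply, mul_inv_cancel]
    exact one_mem _
  mul_mem' := by
    intro a b ha hb x
    have h : abAutHom Γ (a * b) x * x⁻¹ =
        (abAutHom Γ a (abAutHom Γ b x) * (abAutHom Γ b x)⁻¹) * (abAutHom Γ b x * x⁻¹) := by
      simp only [map_mul, MulAut.mul_apply]
      group
    rw [h]
    exact mul_mem (ha _) (hb x)
  inv_mem' := by
    intro a ha x
    have h : abAutHom Γ a (abAutHom Γ a⁻¹ x) = x := by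
      have : abAutHom Γ a * abAutHom Γ a⁻¹ = 1 := by
        rw [← map_mul, mul_inv_cancel, map_one]
      calc abAutHom Γ a (abAutHom Γ a⁻¹ x) = (abAutHom Γ a * abAutHom Γ a⁻¹) x := rfl
        _ = x := by rw [this]; rfl
    have := inv_mem (ha (abAutHom Γ a⁻¹ x))
    rw [h] at this
    simpa [mul_comm] using this
  
/-- `SIA_Γ(m) = SAut⁰(A_Γ) ∩ IA_Γ(m)`. -/
def SIA (Γ : SimpleGraph V) (m : ℕ) : Subgroup (MulAut (Raag Γ)) := SAut0 Γ ⊓ IAm Γ m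

/-- The group of inner automorphisms of `A_Γ`. -/
def innSub (Γ : SimpleGraph V) : Subgroup (MulAut (Raag Γ)) :=
  (MulAut.conj : Raag Γ →* MulAut (Raag Γ)).range


/-- Property (NL): three pairwise distinct, pairwise non-adjacent vertices with
`v₃ ≤ v₁` and `v₃ ≤ v₂`. -/
def NL (Γ : SimpleGraph V) : Prop :=
  ∃ v₁ v₂ v₃ : V, v₁ ≠ v₂ ∧ v₁ ≠ v₃ ∧ v₂ ≠ v₃ ∧
    ¬ Γ.Adj v₁ v₂ ∧ ¬ Γ.Adj v₁ v₃ ∧ ¬ Γ.Adj v₂ v₃ ∧ Le Γ v₃ v₁ ∧ Le Γ v₃ v₂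

open Classical in
/-- The multiset of cardinalities of the equivalence classes of vertices under `∼`. -/
noncomputable def classSizes (Γ : SimpleGraph V) : Multiset ℕ :=
  (Finset.image (fun v => Set.toFinset (simClass Γ v)) Finset.univ).val.map Finset.card

open scoped commutatorElement

set_option linter.unusedSectionVars false

lemma gen_commute {Γ : SimpleGraph V} {x y : V} (h : Γ.Adj x y) :
    Commute (gen Γ x) (gen Γ y) := by
  have h1 : (PresentedGroup.mk (Rels Γ)
      (FreeGroup.of x * FreeGroup.of y * (FreeGroup.of x)⁻¹ * (FreeGroup.of y)⁻¹)) = 1 :=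
    PresentedGroup.one_of_mem ⟨x, y, h, rfl⟩
  rw [map_mul, map_mul, map_mul, map_inv, map_inv, mul_inv_eq_one, mul_inv_eq_iff_eq_mul] at h1
  exact h1

/-- The homomorphism out of `Raag Γ` determined by the images of the vertices. -/
def lift {G : Type*} [Group G] (Γ : SimpleGraph V) (f : V → G)
    (hf : ∀ x y, Γ.Adj x y → Commute (f x) (f y)) : Raag Γ →* G :=
  PresentedGroup.toGroup (f := f) (by
    rintro r ⟨x, y, h, rfl⟩
    simp [(hf x y h).eq])

@[simp] lemma lift_gen {G : Type*} [Group G] (Γ : SimpleGraph V) (f : V → G)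
    (hf : ∀ x y, Γ.Adj x y → Commute (f x) (f y)) (x : V) :
    lift Γ f hf (gen Γ x) = f x :=
  PresentedGroup.toGroup.of _

lemma hom_ext {G : Type*} [Group G] {Γ : SimpleGraph V} {φ ψ : Raag Γ →* G}
    (h : ∀ x, φ (gen Γ x) = ψ (gen Γ x)) : φ = ψ :=
  PresentedGroup.ext h

lemma aut_ext {Γ : SimpleGraph V} {α β : MulAut (Raag Γ)}
    (h : ∀ x, α (gen Γ x) = β (gen Γ x)) : α = β :=
  MulEquiv.toMonoidHom_injective (hom_ext h)

/-- The endomorphism sending `v` to `a` and fixing all other vertices. -/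
def updateHom (Γ : SimpleGraph V) (v : V) (a : Raag Γ)
    (ha : ∀ x, Γ.Adj v x → Commute a (gen Γ x)) : Raag Γ →* Raag Γ :=
  lift Γ (Function.update (gen Γ) v a) (by
    intro x y h
    by_cases hx : x = v
    · subst hx
      simpa [h.ne'] using ha y h
    · by_cases hy : y = v
      · subst hy
        simpa [hx] using (ha x h.symm).symm
      · simpa [hx, hy] using gen_commute h)

lemma updateHom_self {Γ : SimpleGraph V} {v : V} {a : Raag Γ}
    (ha : ∀ x, Γ.Adj v x → Commute a (gen Γ x)) : updateHom Γ v a ha (gen Γ v) = a := by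
  simp [updateHom]

lemma updateHom_of_ne {Γ : SimpleGraph V} {v : V} {a : Raag Γ}
    (ha : ∀ x, Γ.Adj v x → Commute a (gen Γ x)) {z : V} (hz : z ≠ v) :
    updateHom Γ v a ha (gen Γ z) = gen Γ z := by
  simp [updateHom, hz]

lemma updateHom_comp_eq_id {Γ : SimpleGraph V} {v : V} {a b : Raag Γ}
    (ha : ∀ x, Γ.Adj v x → Commute a (gen Γ x)) (hb : ∀ x, Γ.Adj v x → Commute b (gen Γ x))
    (h : updateHom Γ v a ha b = gen Γ v) :
    (updateHom Γ v a ha).comp (updateHom Γ v b hb) = MonoidHom.id _ := by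
  refine hom_ext fun z => ?_
  by_cases hz : z = v
  · subst hz
    simp [updateHom_self, h]
  · simp [updateHom_of_ne, hz]

lemma exists_transvection {Γ : SimpleGraph V} {v w : V} (hne : v ≠ w)
    (hvw : ∀ x, Γ.Adj v x → Γ.Adj w x) :
    ∃ t : MulAut (Raag Γ), t (gen Γ v) = gen Γ v * gen Γ w ∧
      ∀ z, z ≠ v → t (gen Γ z) = gen Γ z := by
  have ha : ∀ x, Γ.Adj v x → Commute (gen Γ v * gen Γ w) (gen Γ x) := fun x hx =>
    (gen_commute hx).mul_left (gen_commute (hvw x hx))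
  have hb : ∀ x, Γ.Adj v x → Commute (gen Γ v * (gen Γ w)⁻¹) (gen Γ x) := fun x hx =>
    (gen_commute hx).mul_left (gen_commute (hvw x hx)).inv_left
  refine ⟨MonoidHom.toMulEquiv (updateHom Γ v _ ha) (updateHom Γ v _ hb)
    (updateHom_comp_eq_id _ _ ?_) (updateHom_comp_eq_id _ _ ?_), updateHom_self ha,
    fun z hz => updateHom_of_ne ha hz⟩ <;>
  simp [updateHom_self, updateHom_of_ne, hne.symm]

lemma exists_conjugation {Γ : SimpleGraph V} {x y : V} (hne : x ≠ y)
    (hxy : ∀ z, Γ.Adj x z → Γ.Adj y z) :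
    ∃ c : MulAut (Raag Γ), c (gen Γ x) = (gen Γ y)⁻¹ * gen Γ x * gen Γ y ∧
      ∀ z, z ≠ x → c (gen Γ z) = gen Γ z := by
  have ha : ∀ z, Γ.Adj x z → Commute ((gen Γ y)⁻¹ * gen Γ x * gen Γ y) (gen Γ z) := fun z hz =>
    ((gen_commute (hxy z hz)).inv_left.mul_left (gen_commute hz)).mul_left
      (gen_commute (hxy z hz))
  have hb : ∀ z, Γ.Adj x z → Commute (gen Γ y * gen Γ x * (gen Γ y)⁻¹) (gen Γ z) := fun z hz =>
    ((gen_commute (hxy z hz)).mul_left (gen_commute hz)).mul_left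
      (gen_commute (hxy z hz)).inv_left
  refine ⟨MonoidHom.toMulEquiv (updateHom Γ x _ ha) (updateHom Γ x _ hb)
    (updateHom_comp_eq_id _ _ ?_) (updateHom_comp_eq_id _ _ ?_), updateHom_self ha,
    fun z hz => updateHom_of_ne ha hz⟩ <;>
  simp [updateHom_self, updateHom_of_ne, hne.symm, mul_assoc]

lemma mem_IAm_of_gen {Γ : SimpleGraph V} {m : ℕ} {α : MulAut (Raag Γ)}
    (h : ∀ z, Abelianization.of (α (gen Γ z)) * (Abelianization.of (gen Γ z))⁻¹ ∈ powN Γ m) :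
    α ∈ IAm Γ m := by
  let ψ : Abelianization (Raag Γ) →* Abelianization (Raag Γ) :=
    (abAutHom Γ α).toMonoidHom * (MonoidHom.id _)⁻¹
  have key : (QuotientGroup.mk' (powN Γ m)).comp (ψ.comp Abelianization.of) = 1 :=
    hom_ext fun z => (QuotientGroup.eq_one_iff _).2 (h z)
  intro x
  obtain ⟨g, rfl⟩ := QuotientGroup.mk_surjective x
  exact (QuotientGroup.eq_one_iff _).1 (DFunLike.congr_fun key g)

lemma conjugation_mem_IAm {Γ : SimpleGraph V} {m : ℕ} {x y : V} {c : MulAut (Raag Γ)}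
    (hx : c (gen Γ x) = (gen Γ y)⁻¹ * gen Γ x * gen Γ y)
    (hz : ∀ z, z ≠ x → c (gen Γ z) = gen Γ z) : c ∈ IAm Γ m := by
  refine mem_IAm_of_gen fun z => ?_
  by_cases h : z = x
  · subst h
    simp [hx, mul_comm, one_mem]
  · simp [hz z h, one_mem]

lemma conjugation_mem_SIA {Γ : SimpleGraph V} {m : ℕ} {x y : V} {c : MulAut (Raag Γ)}
    (hne : x ≠ y) (hnadj : ¬ Γ.Adj y x) (hxy : ∀ z, Γ.Adj x z → Γ.Adj y z)
    (hx : c (gen Γ x) = (gen Γ y)⁻¹ * gen Γ x * gen Γ y)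
    (hz : ∀ z, z ≠ x → c (gen Γ z) = gen Γ z) : c ∈ SIA Γ m := by
  refine ⟨Subgroup.subset_closure (Or.inr ⟨y, {x}, ?_, ?_, fun z h => hz z h⟩),
    conjugation_mem_IAm hx hz⟩
  · have hmem : x ∈ (st Γ y)ᶜ := by simp [st, hne, hnadj]
    refine ⟨(Γ.induce (st Γ y)ᶜ).connectedComponentMk ⟨x, hmem⟩, ?_⟩
    have hisol : ∀ z : ((st Γ y)ᶜ : Set V),
        (Γ.induce (st Γ y)ᶜ).Reachable ⟨x, hmem⟩ z → z = ⟨x, hmem⟩ := by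
      rintro z ⟨p⟩
      cases p with
      | nil => rfl
      | @cons _ b _ h _ => exact absurd (Or.inr (hxy _ h) : (b : V) ∈ st Γ y) b.2
    ext z
    simp only [Set.mem_singleton_iff, Set.mem_image, SimpleGraph.ConnectedComponent.mem_supp_iff,
      SimpleGraph.ConnectedComponent.eq]
    constructor
    · rintro rfl
      exact ⟨⟨z, hmem⟩, SimpleGraph.Reachable.refl _, rfl⟩
    · rintro ⟨a, ha, rfl⟩
      rw [hisol a ha.symm]
  · rintro _ rfl
    exact hx

lemma pow_transvection_apply {Γ : SimpleGraph V} {v w : V} (hne : v ≠ w) {t : MulAut (Raag Γ)}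
    (hv : t (gen Γ v) = gen Γ v * gen Γ w) (hz : ∀ z, z ≠ v → t (gen Γ z) = gen Γ z) (k : ℕ) :
    (t ^ k) (gen Γ v) = gen Γ v * gen Γ w ^ k ∧ ∀ z, z ≠ v → (t ^ k) (gen Γ z) = gen Γ z := by
  induction k with
  | zero => simp
  | succ k ih =>
    refine ⟨?_, fun z h => by rw [pow_succ, MulAut.mul_apply, hz z h, ih.2 z h]⟩
    rw [pow_succ, MulAut.mul_apply, hv, map_mul, ih.1, ih.2 w hne.symm, mul_assoc, ← pow_succ]

lemma pow_conjugation_apply {Γ : SimpleGraph V} {x y : V} (hne : x ≠ y) {c : MulAut (Raag Γ)}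
    (hx : c (gen Γ x) = (gen Γ y)⁻¹ * gen Γ x * gen Γ y)
    (hz : ∀ z, z ≠ x → c (gen Γ z) = gen Γ z) (k : ℕ) :
    (c ^ k) (gen Γ x) = (gen Γ y ^ k)⁻¹ * gen Γ x * gen Γ y ^ k ∧
      ∀ z, z ≠ x → (c ^ k) (gen Γ z) = gen Γ z := by
  induction k with
  | zero => simp
  | succ k ih =>
    refine ⟨?_, fun z h => by rw [pow_succ, MulAut.mul_apply, hz z h, ih.2 z h]⟩
    rw [pow_succ, MulAut.mul_apply, hx, map_mul, map_mul, map_inv, ih.1, ih.2 y hne.symm]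
    group

lemma inv_apply_of_fixed {G : Type*} [Group G] {c : MulAut G} {g : G} (h : c g = g) :
    c⁻¹ g = g := by
  rw [MulAut.inv_apply, MulEquiv.symm_apply_eq, h]

lemma conjugation_inv_apply {Γ : SimpleGraph V} {x y : V} (hne : x ≠ y) {c : MulAut (Raag Γ)}
    (hx : c (gen Γ x) = (gen Γ y)⁻¹ * gen Γ x * gen Γ y)
    (hz : ∀ z, z ≠ x → c (gen Γ z) = gen Γ z) :
    c⁻¹ (gen Γ x) = gen Γ y * gen Γ x * (gen Γ y)⁻¹ := by
  rw [MulAut.inv_apply, MulEquiv.symm_apply_eq, map_mul, map_mul, map_inv, hx, hz y hne.symm]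
  group

lemma pow_transvection_inv_apply {Γ : SimpleGraph V} {v w : V} (hne : v ≠ w)
    {t : MulAut (Raag Γ)} (hv : t (gen Γ v) = gen Γ v * gen Γ w)
    (hz : ∀ z, z ≠ v → t (gen Γ z) = gen Γ z) (k : ℕ) :
    (t ^ k)⁻¹ (gen Γ v) = gen Γ v * (gen Γ w ^ k)⁻¹ := by
  obtain ⟨h1, h2⟩ := pow_transvection_apply hne hv hz k
  rw [MulAut.inv_apply, MulEquiv.symm_apply_eq, map_mul, map_inv, map_pow, h1, h2 w hne.symm]
  group

lemma transvection_mem_SAut0 {Γ : SimpleGraph V} {v w : V} {t : MulAut (Raag Γ)} (hne : v ≠ w)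
    (hvw : ∀ x, Γ.Adj v x → Γ.Adj w x) (hv : t (gen Γ v) = gen Γ v * gen Γ w)
    (hz : ∀ z, z ≠ v → t (gen Γ z) = gen Γ z) : t ∈ SAut0 Γ :=
  Subgroup.subset_closure (Or.inl ⟨v, w, hne, fun x hx => Or.inr (hvw x hx), hv, hz⟩)

lemma pow_transvection_mem_SIA {Γ : SimpleGraph V} {v w : V} {t : MulAut (Raag Γ)} (hne : v ≠ w)
    (hvw : ∀ x, Γ.Adj v x → Γ.Adj w x) (hv : t (gen Γ v) = gen Γ v * gen Γ w)
    (hz : ∀ z, z ≠ v → t (gen Γ z) = gen Γ z) (m : ℕ) : t ^ m ∈ SIA Γ m := by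
  obtain ⟨h1, h2⟩ := pow_transvection_apply hne hv hz m
  refine ⟨pow_mem (transvection_mem_SAut0 hne hvw hv hz) m, mem_IAm_of_gen fun z => ?_⟩
  by_cases h : z = v
  · subst h
    refine ⟨Abelianization.of (gen Γ w), ?_⟩
    simp [h1]
  · simp [h2 z h, one_mem]

/-- Conjugating only `v` by `w ^ m` is the commutator of `t_{vw} ^ m` and `c_{v,{w}}`. -/
lemma pow_conjugation_mem_commutator {Γ : SimpleGraph V} {v w : V} (hne : v ≠ w)
    (hnadj : ¬ Γ.Adj v w) (hvw : ∀ x, Γ.Adj v x ↔ Γ.Adj w x) {τ : MulAut (Raag Γ)}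
    (hv : τ (gen Γ v) = (gen Γ w)⁻¹ * gen Γ v * gen Γ w)
    (hz : ∀ z, z ≠ v → τ (gen Γ z) = gen Γ z) (m : ℕ) :
    τ ^ m ∈ ⁅SIA Γ m, SIA Γ m⁆ := by
  obtain ⟨t, htv, htz⟩ := exists_transvection hne fun x => (hvw x).1
  obtain ⟨δ, hδw, hδz⟩ := exists_conjugation hne.symm fun x => (hvw x).2
  obtain ⟨hTv, hTz⟩ := pow_transvection_apply hne htv htz m
  obtain ⟨hτv, hτz⟩ := pow_conjugation_apply hne hv hz m
  have hTi := pow_transvection_inv_apply hne htv htz m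
  have hδi := conjugation_inv_apply hne.symm hδw hδz
  have hTw := inv_apply_of_fixed (hTz w hne.symm)
  have hδv := inv_apply_of_fixed (hδz v hne)
  have key : τ ^ m = ⁅t ^ m, δ⁆ := by
    have hconjpow : ((gen Γ v)⁻¹ * gen Γ w * gen Γ v) ^ m =
        (gen Γ v)⁻¹ * gen Γ w ^ m * gen Γ v := by
      simpa using conj_pow (a := (gen Γ v)⁻¹) (b := gen Γ w) (i := m)
    refine aut_ext fun z => ?_
    rw [commutatorElement_def, MulAut.mul_apply, MulAut.mul_apply, MulAut.mul_apply]
    by_cases h1 : z = v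
    · subst h1
      rw [hτv, hδv, hTi, map_mul, map_inv, map_pow, hδw, hδz z hne, hconjpow]
      simp only [map_mul, map_inv, map_pow, hTv, hTz w hne.symm]
      group
    · by_cases h2 : z = w
      · subst h2
        rw [hτz z h1, hδi]
        simp only [map_mul, map_inv, map_pow, hTv, hTz z h1, hTw, hTi, hδw, hδz v hne, hconjpow]
        group
      · rw [hτz z h1, inv_apply_of_fixed (hδz z h2), inv_apply_of_fixed (hTz z h1), hδz z h2,
          hTz z h1]
  rw [key]
  exact Subgroup.commutator_mem_commutator
    (pow_transvection_mem_SIA hne (fun x => (hvw x).1) htv htz m)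
    (conjugation_mem_SIA hne.symm hnadj (fun x => (hvw x).2) hδw hδz)

/-- If `T 0 = 1` and `T (k + 1) = T k * σ ^ k τ σ ^ (-k)` then `T k ≡ τ ^ k` modulo `⁅S, S⁆`. -/
lemma pow_mem_commutator_of_recurrence {G : Type*} [Group G] {S : Subgroup G} {σ τ : G}
    (hσ : σ ∈ S) (hτ : τ ∈ S) {T : ℕ → G} (h0 : T 0 = 1)
    (hs : ∀ k, T (k + 1) = T k * (σ ^ k * τ * (σ ^ k)⁻¹)) (k : ℕ) :
    (τ ^ k)⁻¹ * T k ∈ ⁅S, S⁆ := by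
  induction k with
  | zero => simp [h0, one_mem]
  | succ k ih =>
    have h1 : τ⁻¹ * ((τ ^ k)⁻¹ * T k) * τ ∈ ⁅S, S⁆ := by
      have h2 := Subgroup.commutator_mem_commutator (inv_mem hτ)
        (Subgroup.commutator_le_self S ih)
      have h3 := mul_mem h2 ih
      simpa [commutatorElement_def, mul_assoc] using h3
    have h2 := mul_mem h1 (Subgroup.commutator_mem_commutator (inv_mem hτ) (pow_mem hσ k))
    convert h2 using 1
    rw [hs, commutatorElement_def, pow_succ]
    group

/-- The case of three distinct pairwise non-adjacent vertices with the same link. -/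
lemma pow_commutator_transvection_mem_commutator {Γ : SimpleGraph V} {u v w : V}
    (hvu : v ≠ u) (hvw : v ≠ w) (huw : u ≠ w) (hnadj : ¬ Γ.Adj u w)
    (hluw : ∀ x, Γ.Adj u x ↔ Γ.Adj w x) (hlvw : ∀ x, Γ.Adj v x → Γ.Adj w x)
    {τ : MulAut (Raag Γ)}
    (hv : τ (gen Γ v) = gen Γ v * ((gen Γ u)⁻¹ * (gen Γ w)⁻¹ * gen Γ u * gen Γ w))
    (hz : ∀ z, z ≠ v → τ (gen Γ z) = gen Γ z) (m : ℕ) :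
    τ ^ m ∈ ⁅SIA Γ m, SIA Γ m⁆ := by
  obtain ⟨t, htv, htz⟩ := exists_transvection hvw hlvw
  obtain ⟨δ, hδw, hδz⟩ := exists_conjugation huw.symm fun x => (hluw x).2
  obtain ⟨σ, hσu, hσz⟩ := exists_conjugation huw fun x => (hluw x).1
  have hδS : δ ∈ SIA Γ m :=
    conjugation_mem_SIA huw.symm hnadj (fun x => (hluw x).2) hδw hδz
  have hσS : σ ∈ SIA Γ m :=
    conjugation_mem_SIA huw (fun h => hnadj h.symm) (fun x => (hluw x).1) hσu hσz
  have hδi := conjugation_inv_apply huw.symm hδw hδz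
  have hTv : ∀ k, ⁅δ, (t ^ k)⁻¹⁆ (gen Γ v) =
      gen Γ v * ((gen Γ u)⁻¹ * (gen Γ w ^ k)⁻¹ * gen Γ u * gen Γ w ^ k) := fun k => by
    obtain ⟨h1, h2⟩ := pow_transvection_apply hvw htv htz k
    have hconjpow : (gen Γ u * gen Γ w * (gen Γ u)⁻¹) ^ k =
        gen Γ u * gen Γ w ^ k * (gen Γ u)⁻¹ := conj_pow
    have hconjpow' : ((gen Γ u)⁻¹ * gen Γ w * gen Γ u) ^ k =
        (gen Γ u)⁻¹ * gen Γ w ^ k * gen Γ u := by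
      simpa using conj_pow (a := (gen Γ u)⁻¹) (b := gen Γ w) (i := k)
    rw [commutatorElement_def, inv_inv, MulAut.mul_apply, MulAut.mul_apply, MulAut.mul_apply]
    simp only [h1, map_mul, map_inv, map_pow, hδi, inv_apply_of_fixed (hδz v hvw),
      hconjpow, pow_transvection_inv_apply hvw htv htz k,
      inv_apply_of_fixed (h2 u hvu.symm), inv_apply_of_fixed (h2 w hvw.symm),
      hδw, hδz v hvw, hδz u huw, hconjpow']
    group
  have hTz : ∀ k z, z ≠ v → ⁅δ, (t ^ k)⁻¹⁆ (gen Γ z) = gen Γ z := fun k z hzv => by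
    obtain ⟨-, h2⟩ := pow_transvection_apply hvw htv htz k
    rw [commutatorElement_def, inv_inv, MulAut.mul_apply, MulAut.mul_apply, MulAut.mul_apply,
      h2 z hzv]
    by_cases hzw : z = w
    · subst hzw
      simp only [map_mul, map_inv, hδi, inv_apply_of_fixed (h2 u hvu.symm),
        inv_apply_of_fixed (h2 z hzv), hδw, hδz u huw]
      group
    · rw [inv_apply_of_fixed (hδz z hzw), inv_apply_of_fixed (h2 z hzv), hδz z hzw]
  have hτ : τ = ⁅δ, (t ^ 1)⁻¹⁆ := by
    refine aut_ext fun z => ?_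
    by_cases h : z = v
    · subst h
      rw [hv, hTv, pow_one]
    · rw [hz z h, hTz 1 z h]
  have hτS : τ ∈ SIA Γ m := by
    refine ⟨?_, mem_IAm_of_gen fun z => ?_⟩
    · have ht := transvection_mem_SAut0 hvw hlvw htv htz
      rw [hτ]
      exact Subgroup.commutator_le_self _
        (Subgroup.commutator_mem_commutator hδS.1 (inv_mem (pow_mem ht 1)))
    · by_cases h : z = v
      · subst h
        have : Abelianization.of (τ (gen Γ z)) * (Abelianization.of (gen Γ z))⁻¹ = 1 := by
          rw [hv, mul_inv_eq_one]
          simp [mul_comm]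
        rw [this]
        exact one_mem _
      · simp [hz z h, one_mem]
  have hrec : ∀ k, ⁅δ, (t ^ (k + 1))⁻¹⁆ = ⁅δ, (t ^ k)⁻¹⁆ * (σ ^ k * τ * (σ ^ k)⁻¹) := fun k => by
    obtain ⟨h1, h2⟩ := pow_conjugation_apply huw hσu hσz k
    refine aut_ext fun z => ?_
    rw [MulAut.mul_apply, MulAut.mul_apply, MulAut.mul_apply]
    by_cases h : z = v
    · subst h
      rw [hTv, inv_apply_of_fixed (h2 z hvu), hv]
      simp only [map_mul, map_inv, map_pow, h1, h2 z hvu, h2 w huw.symm, hTv,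
        hTz k u hvu.symm, hTz k w hvw.symm]
      group
    · rw [hTz _ z h]
      by_cases hzu : z = u
      · subst hzu
        have h3 : (σ ^ k)⁻¹ (gen Γ z) = gen Γ w ^ k * gen Γ z * (gen Γ w ^ k)⁻¹ := by
          rw [MulAut.inv_apply, MulEquiv.symm_apply_eq]
          simp only [map_mul, map_inv, map_pow, h1, h2 w huw.symm]
          group
        rw [h3]
        simp only [map_mul, map_inv, map_pow, hz z h, hz w hvw.symm, h1, h2 w huw.symm,
          hTz k z h, hTz k w hvw.symm]
        group
      · rw [inv_apply_of_fixed (h2 z hzu), hz z h, h2 z hzu, hTz k z h]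
  have hmem := pow_mem_commutator_of_recurrence hσS hτS
    (T := fun k => ⁅δ, (t ^ k)⁻¹⁆) (by simp) hrec m
  have hT : ⁅δ, (t ^ m)⁻¹⁆ ∈ ⁅SIA Γ m, SIA Γ m⁆ :=
    Subgroup.commutator_mem_commutator hδS
      (inv_mem (pow_transvection_mem_SIA hvw hlvw htv htz m))
  exact inv_mem_iff.1 ((Subgroup.mul_mem_cancel_right _ hT).1 hmem)

/-- For non-adjacent `u ≠ v` the endomorphism `v ↦ v[u,v]` is not surjective: map `u` and `v` to
a transposition and a `3`-cycle in `S₃`. -/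
lemma not_exists_aut_mul_commutator_self {Γ : SimpleGraph V} {u v : V} (hne : u ≠ v)
    (hnadj : ¬ Γ.Adj u v) (τ : MulAut (Raag Γ))
    (hv : τ (gen Γ v) = gen Γ v * ((gen Γ u)⁻¹ * (gen Γ v)⁻¹ * gen Γ u * gen Γ v))
    (hz : ∀ z, z ≠ v → τ (gen Γ z) = gen Γ z) : False := by
  let a : Equiv.Perm (Fin 3) := Equiv.swap 0 1
  let b : Equiv.Perm (Fin 3) := finRotate 3
  have hab : b * (a⁻¹ * b⁻¹ * a * b) = 1 := by decide
  have hnc : ¬ Commute b a := by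
    intro h
    exact absurd h.eq (by decide)
  let f : V → Equiv.Perm (Fin 3) := fun x => if x = u then a else if x = v then b else 1
  have hfu : f u = a := by simp [f]
  have hfv : f v = b := by simp [f, hne.symm]
  have hf1 : ∀ x, x ≠ u → x ≠ v → f x = 1 := fun x h1 h2 => by simp [f, h1, h2]
  have hf : ∀ x y, Γ.Adj x y → Commute (f x) (f y) := by
    intro x y h
    by_cases hxu : x = u
    · subst hxu
      rw [hf1 y h.ne' (by rintro rfl; exact hnadj h)]
      exact Commute.one_right _
    · by_cases hxv : x = v
      · subst hxv
        rw [hf1 y (by rintro rfl; exact hnadj h.symm) h.ne']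
        exact Commute.one_right _
      · rw [hf1 x hxu hxv]
        exact Commute.one_left _
  have hcomp : (lift Γ f hf).comp τ.toMonoidHom =
      lift Γ (fun x => if x = u then a else 1) (by intro x y _; split_ifs <;> simp) := by
    refine hom_ext fun x => ?_
    by_cases hxv : x = v
    · subst hxv
      simp only [MonoidHom.comp_apply, MulEquiv.coe_toMonoidHom, hv, map_mul, map_inv, lift_gen,
        hfu, hfv, hab, hne.symm, if_false]
    · by_cases hxu : x = u
      · subst hxu
        simp [hz x hxv, hfu]
      · simp [hz x hxv, hxu, hf1 x hxu hxv]
  have hcent : ∀ g, Commute (lift Γ f hf (τ g)) a := by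
    intro g
    have : (MulAut.conj a).toMonoidHom.comp ((lift Γ f hf).comp τ.toMonoidHom) =
        (lift Γ f hf).comp τ.toMonoidHom := by
      rw [hcomp]
      refine hom_ext fun x => ?_
      by_cases hxu : x = u <;> simp [hxu]
    have h := DFunLike.congr_fun this g
    simp only [MonoidHom.comp_apply, MulEquiv.coe_toMonoidHom, MulAut.conj_apply,
      mul_inv_eq_iff_eq_mul] at h
    exact h.symm
  have := hcent (τ.symm (gen Γ v))
  rw [MulEquiv.apply_symm_apply, lift_gen, hfv] at this
  exact hnc this

lemma adj_iff_of_B1 {Γ : SimpleGraph V} (hB1 : B1 Γ) {x y : V} (hne : x ≠ y)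
    (hnadj : ¬ Γ.Adj x y) (z : V) : Γ.Adj x z ↔ Γ.Adj y z := by
  obtain ⟨h1, h2⟩ := hB1 x y hne hnadj
  refine ⟨fun h => (h1 h).resolve_left ?_, fun h => (h2 h).resolve_left ?_⟩
  · rintro rfl
    exact hnadj h
  · rintro rfl
    exact hnadj h.symm

theorem tau_power_in_commutator (Γ : SimpleGraph V) (hB1 : B1 Γ)
    (u v w : V) (hlk : lk Γ v ⊆ st Γ u ∩ st Γ w)
    (τ : MulAut (Raag Γ))
    (hτv : τ (gen Γ v) =
      gen Γ v * ((gen Γ u)⁻¹ * (gen Γ w)⁻¹ * gen Γ u * gen Γ w))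
    (hτz : ∀ z : V, z ≠ v → τ (gen Γ z) = gen Γ z)
    (m : ℕ) :
    τ ^ m ∈ ⁅SIA Γ m, SIA Γ m⁆ := by
  by_cases hcomm : Commute (gen Γ u) (gen Γ w)
  · have : τ = 1 := by
      refine aut_ext fun z => ?_
      by_cases h : z = v
      · subst h
        rw [hτv, mul_assoc _ (gen Γ u), hcomm.eq]
        simp [mul_assoc]
      · simp [hτz z h]
    rw [this, one_pow]
    exact one_mem _
  have huw : u ≠ w := by
    rintro rfl
    exact hcomm (Commute.refl _)
  have hnuw : ¬ Γ.Adj u w := fun h => hcomm (gen_commute h)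
  have hnvu : ¬ Γ.Adj v u := fun h => (hlk h).2.elim huw fun h' => hnuw (SimpleGraph.Adj.symm h')
  have hnvw : ¬ Γ.Adj v w := fun h => (hlk h).1.elim huw.symm hnuw
  by_cases hvw : v = w
  · subst hvw
    exact (not_exists_aut_mul_commutator_self huw hnuw τ hτv hτz).elim
  by_cases hvu : v = u
  · subst hvu
    refine pow_conjugation_mem_commutator hvw hnvw (adj_iff_of_B1 hB1 hvw hnvw) ?_ hτz m
    rw [hτv]
    group
  · exact pow_commutator_transvection_mem_commutator hvu hvw huw hnuw
      (adj_iff_of_B1 hB1 huw hnuw) (fun x => (adj_iff_of_B1 hB1 hvw hnvw x).1) hτv hτz m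

end RaagPaper
end

section
/- Let Γ be a finite simplicial graph and v a vertex. Then the induced subgraph of Γ on the equivalence class [v] of v under ∼ is either complete (every two distinct vertices of [v] are adjacent) or totally disconnected (no two vertices of [v] are adjacent). -/
open SimpleGraph

namespace RaagPaper

variable {V : Type} [Fintype V] [DecidableEq V]

theorem Le.trans {Γ : SimpleGraph V} {a b c : V} (hab : Le Γ a b) (hbc : Le Γ b c) :
    Le Γ a c := by
  intro x hx
  rcases hab hx with rfl | hbx
  · rcases hbc (SimpleGraph.Adj.symm hx) with rfl | hca
    · exact Or.inr hx
    · rcases hab (SimpleGraph.Adj.symm hca) with rfl | hxc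
      · exact Or.inl rfl
      · exact Or.inr (SimpleGraph.Adj.symm hxc)
  · exact hbc hbx

theorem Sim.symm {Γ : SimpleGraph V} {a b : V} (h : Sim Γ a b) : Sim Γ b a := ⟨h.2, h.1⟩

theorem Sim.trans {Γ : SimpleGraph V} {a b c : V} (hab : Sim Γ a b) (hbc : Sim Γ b c) :
    Sim Γ a c :=
  ⟨hab.1.trans hbc.1, hbc.2.trans hab.2⟩

/-- If `a` is adjacent to an equivalent vertex, then its star contains its equivalence class. -/
theorem Sim.mem_st_of_adj {Γ : SimpleGraph V} {a b c : V} (hab : Sim Γ a b) (hadj : Γ.Adj a b)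
    (hac : Sim Γ a c) : c ∈ st Γ a := by
  rcases hac.1 hadj with rfl | hcb
  · exact Or.inr hadj
  · exact hab.2 (SimpleGraph.Adj.symm hcb)

theorem simClass_complete_or_totally_disconnected (Γ : SimpleGraph V) (v : V) :
    (∀ u₁ ∈ simClass Γ v, ∀ u₂ ∈ simClass Γ v, u₁ ≠ u₂ → Γ.Adj u₁ u₂) ∨
    (∀ u₁ ∈ simClass Γ v, ∀ u₂ ∈ simClass Γ v, ¬ Γ.Adj u₁ u₂) := by
  refine or_iff_not_imp_right.mpr fun h => ?_
  push Not at h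
  obtain ⟨a, ha, b, hb, hadj⟩ := h
  intro x hx y hy hxy
  have hax : Sim Γ a x := ha.trans hx.symm
  have hmem (c : V) (hc : c ∈ simClass Γ v) : c ∈ st Γ a :=
    (ha.trans hb.symm).mem_st_of_adj hadj (ha.trans hc.symm)
  rcases hmem x hx with rfl | hadjx
  · exact (hmem y hy).resolve_left hxy.symm
  · exact (hax.symm.mem_st_of_adj (SimpleGraph.Adj.symm hadjx)
      (hx.trans hy.symm)).resolve_left hxy.symm

end RaagPaper
end
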